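/- The average stabilizer-entropy gap of the SU(2)-gauge invariant intertwiner subspace of four qubits equals 8/45: ΔM(H_I) := ∫_{U(2)} M_lin^{(0)}( u₀₀|0_s⟩ + u₁₀|1_s⟩ ) dμ(U) − ∫_{U(2)} M_lin^{(I)}( U e₀ ) dμ(U) = 17/45 − 1/5 = 8/45, where (u₀₀, u₁₀) is the first column of U ∈ U(2). -/

import Mathlib

open Matrix MeasureTheory BigOperators

noncomputable section

/-- The four 2×2 Pauli matrices: σ₀ = I, σ₁ = X, σ₂ = Y, σ₃ = Z. -/
def pauli : Fin 4 → Matrix (Fin 2) (Fin 2) ℂ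
  | 0 => 1
  | 1 => !![0, 1; 1, 0]
  | 2 => !![0, -Complex.I; Complex.I, 0]
  | 3 => !![1, 0; 0, -1]

/-- Pauli string `σ_{f(1)} ⊗ ⋯ ⊗ σ_{f(n)}` on `n` qubits, as a matrix on
`(ℂ²)^⊗n`, realized as functions `(Fin n → Fin 2) → ℂ`. -/
def pauliString {n : ℕ} (f : Fin n → Fin 4) :
    Matrix (Fin n → Fin 2) (Fin n → Fin 2) ℂ :=
  Matrix.of fun r c => ∏ k, pauli (f k) (r k) (c k)

/-- Computational basis vector `|b₁…b_n⟩`. -/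
def ket {n : ℕ} (b : Fin n → Fin 2) : (Fin n → Fin 2) → ℂ :=
  fun i => if i = b then 1 else 0

/-- Logical intertwiner basis vector
`|0_s⟩ = ½(|0101⟩+|1010⟩−|0110⟩−|1001⟩)`. -/
def zeroS : (Fin 4 → Fin 2) → ℂ :=
  (2 : ℂ)⁻¹ • (ket ![0,1,0,1] + ket ![1,0,1,0] - ket ![0,1,1,0] - ket ![1,0,0,1])

/-- Logical intertwiner basis vector
`|1_s⟩ = (1/√3)[|0011⟩+|1100⟩ − ½(|0101⟩+|1010⟩+|0110⟩+|1001⟩)]`. -/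
def oneS : (Fin 4 → Fin 2) → ℂ :=
  ((Real.sqrt 3 : ℂ))⁻¹ • (ket ![0,0,1,1] + ket ![1,1,0,0]
    - (2 : ℂ)⁻¹ • (ket ![0,1,0,1] + ket ![1,0,1,0] + ket ![0,1,1,0] + ket ![1,0,0,1]))

/-- Borel measurable structure on the unitary group. -/
instance (ι : Type*) [Fintype ι] [DecidableEq ι] :
    MeasurableSpace (Matrix.unitaryGroup ι ℂ) := borel _

instance (ι : Type*) [Fintype ι] [DecidableEq ι] :
    BorelSpace (Matrix.unitaryGroup ι ℂ) := ⟨rfl⟩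

/-- The linear stabilizer entropy of a 4-qubit state with respect to the full
4-qubit Pauli basis `𝒫₄` (`d₀ = 16`): `M_lin⁽⁰⁾(ψ) = 1 − d₀⁻¹ Σ_{P∈𝒫₄} ⟨ψ|P|ψ⟩⁴`.
Since `⟨ψ|P|ψ⟩` is real for Hermitian `P`, we take its real part. -/
def Mlin0 (ψ : (Fin 4 → Fin 2) → ℂ) : ℝ :=
  1 - (16 : ℝ)⁻¹ * ∑ f : Fin 4 → Fin 4, ((star ψ ⬝ᵥ (pauliString f).mulVec ψ).re) ^ 4

/-- The linear stabilizer entropy of a single-qubit (logical) state with respect to the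
single-qubit Pauli basis `𝒫₁` (`d_I = 2`): `M_lin⁽ᴵ⁾(φ) = 1 − d_I⁻¹ Σ_{P∈𝒫₁} ⟨φ|P|φ⟩⁴`. -/
def MlinI (φ : Fin 2 → ℂ) : ℝ :=
  1 - (2 : ℝ)⁻¹ * ∑ a : Fin 4, ((star φ ⬝ᵥ (pauli a).mulVec φ).re) ^ 4

/-- The state with amplitudes `p`, `q`, `t` on the three spin-flip symmetric pairs
`|0101⟩+|1010⟩`, `|0110⟩+|1001⟩`, `|0011⟩+|1100⟩`. -/
def pairState (p q t : ℂ) : (Fin 4 → Fin 2) → ℂ :=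
  p • (ket ![0,1,0,1] + ket ![1,0,1,0]) + q • (ket ![0,1,1,0] + ket ![1,0,0,1])
    + t • (ket ![0,0,1,1] + ket ![1,1,0,0])

lemma sum_fin_four_fun {α M : Type*} [Fintype α] [AddCommMonoid M] (F : (Fin 4 → α) → M) :
    ∑ f, F f = ∑ a, ∑ b, ∑ c, ∑ d, F ![a, b, c, d] := by
  simp only [← (Fin.consEquiv fun _ => α).sum_comp, Fintype.sum_prod_type, Fintype.sum_unique]
  rfl

lemma ket_apply_vec (a b c d a' b' c' d' : Fin 2) :
    ket ![a, b, c, d] ![a', b', c', d'] =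
      if a' = a ∧ b' = b ∧ c' = c ∧ d' = d then 1 else 0 := by
  simp [ket, Matrix.vecCons_inj]

lemma pauli_zero : pauli 0 = !![1, 0; 0, 1] := Matrix.one_fin_two

lemma pauli_one : pauli 1 = !![0, 1; 1, 0] := rfl

lemma pauli_two : pauli 2 = !![0, -Complex.I; Complex.I, 0] := rfl

lemma pauli_three : pauli 3 = !![1, 0; 0, -1] := rfl

set_option maxHeartbeats 4000000 in
lemma pauliString_pairState_pow_four (p₁ p₂ q₁ q₂ : ℝ) (a b c d : Fin 4) :
    let p : ℂ := ⟨p₁, p₂⟩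
    let q : ℂ := ⟨q₁, q₂⟩
    let ψ := pairState p q (-p - q)
    let P := p₁ ^ 2 + p₂ ^ 2
    let Q := q₁ ^ 2 + q₂ ^ 2
    let T := (p₁ + q₁) ^ 2 + (p₂ + q₂) ^ 2
    ((star ψ ⬝ᵥ (pauliString ![a, b, c, d]).mulVec ψ).re) ^ 4 =
      if a = b then
        if c = d then if a = c then (2 * (P + Q + T)) ^ 4 else (2 * (T - P - Q)) ^ 4 else 0
      else if a = c ∧ b = d then (2 * (P - Q - T)) ^ 4
      else if a = d ∧ b = c then (2 * (Q - P - T)) ^ 4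
      else if c ≠ d ∧ a ≠ c ∧ a ≠ d ∧ b ≠ c ∧ b ≠ d then (4 * (p₁ * q₂ - p₂ * q₁)) ^ 4
      else 0 := by
  intro p q ψ P Q T
  simp only [ψ, dotProduct, mulVec, sum_fin_four_fun, Fin.sum_univ_two, pairState, Pi.star_apply,
    Pi.add_apply, Pi.smul_apply, ket_apply_vec]
  simp [pauliString, Fin.prod_univ_four]
  fin_cases a <;> fin_cases b <;>
  · simp [pauli_zero, pauli_one, pauli_two, pauli_three]
    fin_cases c <;> fin_cases d <;>
    · simp [pauli_zero, pauli_one, pauli_two, pauli_three, p, q, P, Q, T] <;> ring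

lemma sum_pauliString_pairState_pow_four (p₁ p₂ q₁ q₂ : ℝ) :
    let p : ℂ := ⟨p₁, p₂⟩
    let q : ℂ := ⟨q₁, q₂⟩
    let ψ := pairState p q (-p - q)
    let P := p₁ ^ 2 + p₂ ^ 2
    let Q := q₁ ^ 2 + q₂ ^ 2
    let T := (p₁ + q₁) ^ 2 + (p₂ + q₂) ^ 2
    ∑ f, ((star ψ ⬝ᵥ (pauliString f).mulVec ψ).re) ^ 4 =
      4 * (2 * (P + Q + T)) ^ 4 + 12 * ((2 * (T - P - Q)) ^ 4 + (2 * (P - Q - T)) ^ 4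
        + (2 * (Q - P - T)) ^ 4) + 24 * (4 * (p₁ * q₂ - p₂ * q₁)) ^ 4 := by
  intro p q ψ P Q T
  simp only [sum_fin_four_fun, ψ, p, q, pauliString_pairState_pow_four]
  simp only [Fin.sum_univ_four]
  simp [P, Q, T]
  ring

/-- The `x`-coordinate of the Bloch vector of a (not necessarily normalized) qubit state. -/
def blochX (v : Fin 2 → ℂ) : ℝ := 2 * ((v 0).re * (v 1).re + (v 0).im * (v 1).im)

/-- The `y`-coordinate of the Bloch vector of a (not necessarily normalized) qubit state. -/
def blochY (v : Fin 2 → ℂ) : ℝ := 2 * ((v 0).re * (v 1).im - (v 0).im * (v 1).re)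

/-- The `z`-coordinate of the Bloch vector of a (not necessarily normalized) qubit state. -/
def blochZ (v : Fin 2 → ℂ) : ℝ :=
  (v 0).re ^ 2 + (v 0).im ^ 2 - ((v 1).re ^ 2 + (v 1).im ^ 2)

lemma normSq_of_unit {v : Fin 2 → ℂ} (hv : star v ⬝ᵥ v = 1) :
    (v 0).re ^ 2 + (v 0).im ^ 2 + ((v 1).re ^ 2 + (v 1).im ^ 2) = 1 := by
  have h := congrArg Complex.re hv
  simp [dotProduct] at h
  linarith

lemma bloch_sq_of_unit {v : Fin 2 → ℂ} (hv : star v ⬝ᵥ v = 1) :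
    blochX v ^ 2 + blochY v ^ 2 + blochZ v ^ 2 = 1 := by
  rw [← one_pow 2, ← normSq_of_unit hv, blochX, blochY, blochZ]
  ring

lemma MlinI_of_unit {v : Fin 2 → ℂ} (hv : star v ⬝ᵥ v = 1) :
    MlinI v = 1 - 2⁻¹ * (1 + blochX v ^ 4 + blochY v ^ 4 + blochZ v ^ 4) := by
  have h0 : (star v ⬝ᵥ (pauli 0).mulVec v).re = 1 := by simp [pauli, hv]
  have h1 : (star v ⬝ᵥ (pauli 1).mulVec v).re = blochX v := by
    simp [pauli, dotProduct, mulVec, Fin.sum_univ_two, blochX]; ring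
  have h2 : (star v ⬝ᵥ (pauli 2).mulVec v).re = blochY v := by
    simp [pauli, dotProduct, mulVec, Fin.sum_univ_two, blochY]; ring
  have h3 : (star v ⬝ᵥ (pauli 3).mulVec v).re = blochZ v := by
    simp [pauli, dotProduct, mulVec, Fin.sum_univ_two, blochZ]; ring
  rw [MlinI, Fin.sum_univ_four, h0, h1, h2, h3]
  ring

lemma smul_zeroS_add_smul_oneS (α β : ℂ) :
    α • zeroS + β • oneS =
      pairState (α / 2 - β / (2 * (Real.sqrt 3 : ℂ))) (-α / 2 - β / (2 * (Real.sqrt 3 : ℂ)))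
        (β / (Real.sqrt 3 : ℂ)) := by
  ext i
  simp only [zeroS, oneS, pairState, Pi.add_apply, Pi.smul_apply, Pi.sub_apply, smul_eq_mul]
  ring

lemma Mlin0_of_unit {v : Fin 2 → ℂ} (hv : star v ⬝ᵥ v = 1) :
    Mlin0 (v 0 • zeroS + v 1 • oneS) =
      1 - 16⁻¹ * (4 + 12 / 81 * ((1 + 2 * blochZ v) ^ 4
        + (1 - blochZ v + √3 * blochX v) ^ 4 + (1 - blochZ v - √3 * blochX v) ^ 4)
        + 24 / 9 * blochY v ^ 4) := by
  have hN := normSq_of_unit hv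
  obtain ⟨r, hr⟩ : ∃ r : ℝ, r = (√3)⁻¹ := ⟨_, rfl⟩
  have hr2 : r ^ 2 = 1 / 3 := by rw [hr, inv_pow, Real.sq_sqrt (by norm_num)]; norm_num
  have h3 : √3 = 3 * r := by
    have : √3 * √3 = 3 := Real.mul_self_sqrt (by norm_num)
    rw [hr]; field_simp; linarith
  have key := sum_pauliString_pairState_pow_four
    ((v 0).re / 2 - r * (v 1).re / 2) ((v 0).im / 2 - r * (v 1).im / 2)
    (-(v 0).re / 2 - r * (v 1).re / 2) (-(v 0).im / 2 - r * (v 1).im / 2)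
  have hrc : ((√3 : ℝ) : ℂ)⁻¹ = (r : ℂ) := by rw [hr]; push_cast; rfl
  have hp : (⟨(v 0).re / 2 - r * (v 1).re / 2, (v 0).im / 2 - r * (v 1).im / 2⟩ : ℂ)
      = v 0 / 2 - v 1 / (2 * (√3 : ℝ)) := by
    rw [div_eq_mul_inv (v 1), mul_inv, hrc]
    apply Complex.ext <;> simp <;> ring
  have hq : (⟨-(v 0).re / 2 - r * (v 1).re / 2, -(v 0).im / 2 - r * (v 1).im / 2⟩ : ℂ)
      = -v 0 / 2 - v 1 / (2 * (√3 : ℝ)) := by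
    rw [div_eq_mul_inv (v 1), mul_inv, hrc]
    apply Complex.ext <;> simp <;> ring
  have ht : -(v 0 / 2 - v 1 / (2 * (√3 : ℝ))) - (-v 0 / 2 - v 1 / (2 * (√3 : ℝ)))
      = v 1 / ((√3 : ℝ) : ℂ) := by ring
  simp only [hp, hq, ht] at key
  have hA : 2 * (((v 0).re / 2 - r * (v 1).re / 2) ^ 2 + ((v 0).im / 2 - r * (v 1).im / 2) ^ 2
      + ((-(v 0).re / 2 - r * (v 1).re / 2) ^ 2 + (-(v 0).im / 2 - r * (v 1).im / 2) ^ 2)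
      + (((v 0).re / 2 - r * (v 1).re / 2 + (-(v 0).re / 2 - r * (v 1).re / 2)) ^ 2
      + ((v 0).im / 2 - r * (v 1).im / 2 + (-(v 0).im / 2 - r * (v 1).im / 2)) ^ 2)) = 1 := by
    linear_combination hN + 3 * ((v 1).re ^ 2 + (v 1).im ^ 2) * hr2
  have hB : 2 * (((v 0).re / 2 - r * (v 1).re / 2 + (-(v 0).re / 2 - r * (v 1).re / 2)) ^ 2
      + ((v 0).im / 2 - r * (v 1).im / 2 + (-(v 0).im / 2 - r * (v 1).im / 2)) ^ 2
      - (((v 0).re / 2 - r * (v 1).re / 2) ^ 2 + ((v 0).im / 2 - r * (v 1).im / 2) ^ 2)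
      - ((-(v 0).re / 2 - r * (v 1).re / 2) ^ 2 + (-(v 0).im / 2 - r * (v 1).im / 2) ^ 2))
      = -(1 + 2 * blochZ v) / 3 := by
    rw [blochZ]
    linear_combination ((v 1).re ^ 2 + (v 1).im ^ 2) * hr2 - 1 / 3 * hN
  have hC : 2 * (((v 0).re / 2 - r * (v 1).re / 2) ^ 2 + ((v 0).im / 2 - r * (v 1).im / 2) ^ 2
      - ((-(v 0).re / 2 - r * (v 1).re / 2) ^ 2 + (-(v 0).im / 2 - r * (v 1).im / 2) ^ 2)
      - (((v 0).re / 2 - r * (v 1).re / 2 + (-(v 0).re / 2 - r * (v 1).re / 2)) ^ 2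
      + ((v 0).im / 2 - r * (v 1).im / 2 + (-(v 0).im / 2 - r * (v 1).im / 2)) ^ 2))
      = -(1 - blochZ v + 3 * r * blochX v) / 3 := by
    rw [blochZ, blochX]
    linear_combination -2 * ((v 1).re ^ 2 + (v 1).im ^ 2) * hr2 - 1 / 3 * hN
  have hD : 2 * ((-(v 0).re / 2 - r * (v 1).re / 2) ^ 2 + (-(v 0).im / 2 - r * (v 1).im / 2) ^ 2
      - (((v 0).re / 2 - r * (v 1).re / 2) ^ 2 + ((v 0).im / 2 - r * (v 1).im / 2) ^ 2)
      - (((v 0).re / 2 - r * (v 1).re / 2 + (-(v 0).re / 2 - r * (v 1).re / 2)) ^ 2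
      + ((v 0).im / 2 - r * (v 1).im / 2 + (-(v 0).im / 2 - r * (v 1).im / 2)) ^ 2))
      = -(1 - blochZ v - 3 * r * blochX v) / 3 := by
    rw [blochZ, blochX]
    linear_combination -2 * ((v 1).re ^ 2 + (v 1).im ^ 2) * hr2 - 1 / 3 * hN
  have hE : 4 * (((v 0).re / 2 - r * (v 1).re / 2) * (-(v 0).im / 2 - r * (v 1).im / 2)
      - ((v 0).im / 2 - r * (v 1).im / 2) * (-(v 0).re / 2 - r * (v 1).re / 2))
      = -(r * blochY v) := by
    rw [blochY]
    ring
  rw [hA, hB, hC, hD, hE] at key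
  rw [Mlin0, smul_zeroS_add_smul_oneS, key, h3]
  linear_combination -16⁻¹ * 24 * blochY v ^ 4 * (r ^ 2 + 1 / 3) * hr2

instance (ι : Type*) [Fintype ι] [DecidableEq ι] : CompactSpace (Matrix.unitaryGroup ι ℂ) := by
  have hK : IsCompact (Set.univ.pi fun _ : ι => Set.univ.pi fun _ : ι =>
      Metric.closedBall (0 : ℂ) 1) :=
    isCompact_univ_pi fun _ => isCompact_univ_pi fun _ => isCompact_closedBall 0 1
  refine isCompact_iff_compactSpace.mp <|
    IsCompact.of_isClosed_subset (X := Matrix ι ι ℂ) hK isClosed_unitary fun U hU i _ j _ => ?_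
  simpa using entry_norm_bound_of_unitary hU i j

lemma star_mulVec_dotProduct_mulVec_of_unitary {ι : Type*} [Fintype ι] [DecidableEq ι]
    (U : Matrix.unitaryGroup ι ℂ) (e : ι → ℂ) :
    star ((U : Matrix ι ι ℂ) *ᵥ e) ⬝ᵥ ((U : Matrix ι ι ℂ) *ᵥ e) = star e ⬝ᵥ e := by
  rw [star_mulVec, ← dotProduct_mulVec, mulVec_mulVec, ← star_eq_conjTranspose,
    Matrix.UnitaryGroup.star_mul_self, one_mulVec]

section LeftTranslation

lemma continuous_blochX : Continuous blochX := by unfold blochX; fun_prop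

lemma continuous_blochY : Continuous blochY := by unfold blochY; fun_prop

lemma continuous_blochZ : Continuous blochZ := by unfold blochZ; fun_prop

lemma continuous_unitary_mulVec (e : Fin 2 → ℂ) :
    Continuous fun U : Matrix.unitaryGroup (Fin 2) ℂ => (U : Matrix (Fin 2) (Fin 2) ℂ) *ᵥ e :=
  continuous_subtype_val.matrix_mulVec continuous_const

/-- The continuous function `U ↦ F (U e)` on the unitary group. -/
def onOrbit (e : Fin 2 → ℂ) (F : (Fin 2 → ℂ) → ℝ) (hF : Continuous F) :
    C(Matrix.unitaryGroup (Fin 2) ℂ, ℝ) :=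
  ⟨fun U => F ((U : Matrix (Fin 2) (Fin 2) ℂ) *ᵥ e), hF.comp (continuous_unitary_mulVec e)⟩

/-- Left translation by `g` on continuous functions on the unitary group. -/
def leftTranslate (g : Matrix.unitaryGroup (Fin 2) ℂ) :
    C(Matrix.unitaryGroup (Fin 2) ℂ, ℝ) →ₐ[ℝ] C(Matrix.unitaryGroup (Fin 2) ℂ, ℝ) :=
  ContinuousMap.compRightAlgHom ℝ ℝ ⟨(g * ·), continuous_const_mul g⟩

/-- Integration of continuous functions on the unitary group. -/
def haarMean (μ : Measure (Matrix.unitaryGroup (Fin 2) ℂ)) [IsFiniteMeasure μ] :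
    C(Matrix.unitaryGroup (Fin 2) ℂ, ℝ) →ₗ[ℝ] ℝ where
  toFun f := ∫ U, f U ∂μ
  map_add' f g := integral_add
    (f.continuous.integrable_of_hasCompactSupport (HasCompactSupport.of_compactSpace f))
    (g.continuous.integrable_of_hasCompactSupport (HasCompactSupport.of_compactSpace g))
  map_smul' c f := integral_const_mul c f

lemma haarMean_leftTranslate (μ : Measure (Matrix.unitaryGroup (Fin 2) ℂ)) [IsFiniteMeasure μ]
    [μ.IsHaarMeasure] (g : Matrix.unitaryGroup (Fin 2) ℂ)
    (f : C(Matrix.unitaryGroup (Fin 2) ℂ, ℝ)) : haarMean μ (leftTranslate g f) = haarMean μ f :=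
  integral_mul_left_eq_self (μ := μ) f g

lemma leftTranslate_onOrbit_apply (g U : Matrix.unitaryGroup (Fin 2) ℂ) (e : Fin 2 → ℂ)
    (F : (Fin 2 → ℂ) → ℝ) (hF : Continuous F) :
    leftTranslate g (onOrbit e F hF) U =
      F ((g : Matrix (Fin 2) (Fin 2) ℂ) *ᵥ ((U : Matrix (Fin 2) (Fin 2) ℂ) *ᵥ e)) := by
  rw [mulVec_mulVec]
  rfl

lemma exists_unitary_rotate (θ : ℝ) : ∃ g : Matrix.unitaryGroup (Fin 2) ℂ, ∀ v : Fin 2 → ℂ,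
    blochX ((g : Matrix (Fin 2) (Fin 2) ℂ) *ᵥ v) = Real.cos θ * blochX v + Real.sin θ * blochZ v ∧
    blochY ((g : Matrix (Fin 2) (Fin 2) ℂ) *ᵥ v) = blochY v ∧
    blochZ ((g : Matrix (Fin 2) (Fin 2) ℂ) *ᵥ v) =
      Real.cos θ * blochZ v - Real.sin θ * blochX v := by
  obtain ⟨φ, rfl⟩ : ∃ φ, θ = 2 * φ := ⟨θ / 2, by ring⟩
  have hcs := Real.sin_sq_add_cos_sq φ
  have hg : !![(Real.cos φ : ℂ), -(Real.sin φ : ℂ); (Real.sin φ : ℂ), (Real.cos φ : ℂ)] ∈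
      Matrix.unitaryGroup (Fin 2) ℂ := by
    have hcs' : (Real.sin φ : ℂ) ^ 2 + (Real.cos φ : ℂ) ^ 2 = 1 := mod_cast hcs
    rw [Matrix.mem_unitaryGroup_iff]
    ext i j
    fin_cases i <;> fin_cases j <;>
      simp [Matrix.mul_apply, Fin.sum_univ_two, star_eq_conjTranspose, -Complex.ofReal_cos,
        -Complex.ofReal_sin] <;>
      first | linear_combination hcs' | ring
  refine ⟨⟨_, hg⟩, fun v => ⟨?_, ?_, ?_⟩⟩ <;>
    simp [blochX, blochY, blochZ, mulVec, dotProduct, Fin.sum_univ_two, -Complex.ofReal_cos,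
        -Complex.ofReal_sin, Real.cos_two_mul', Real.sin_two_mul]
  · ring
  · linear_combination ((v 0).re * (v 1).im - (v 0).im * (v 1).re) * hcs
  · ring

lemma exists_unitary_phase : ∃ g : Matrix.unitaryGroup (Fin 2) ℂ, ∀ v : Fin 2 → ℂ,
    blochX ((g : Matrix (Fin 2) (Fin 2) ℂ) *ᵥ v) = -blochY v ∧
    blochY ((g : Matrix (Fin 2) (Fin 2) ℂ) *ᵥ v) = blochX v ∧
    blochZ ((g : Matrix (Fin 2) (Fin 2) ℂ) *ᵥ v) = blochZ v := by
  have hg : !![1, 0; 0, Complex.I] ∈ Matrix.unitaryGroup (Fin 2) ℂ := by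
    rw [Matrix.mem_unitaryGroup_iff]
    ext i j
    fin_cases i <;> fin_cases j <;>
      simp [Matrix.mul_apply, Fin.sum_univ_two, star_eq_conjTranspose]
  refine ⟨⟨_, hg⟩, fun v => ⟨?_, ?_, ?_⟩⟩ <;>
    simp [blochX, blochY, blochZ, mulVec, dotProduct, Fin.sum_univ_two] <;> ring

end LeftTranslation

/-- A linear functional on a commutative algebra that is normalized, supported on the unit sphere
in the coordinates `X`, `Y`, `Z`, and invariant under rotations about the `y`-axis and under a
quarter turn about the `z`-axis. -/
structure IsSphereMean {A : Type*} [CommRing A] [Algebra ℝ A] (L : A →ₗ[ℝ] ℝ) (X Y Z : A) :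
    Prop where
  map_one : L 1 = 1
  sq_add_sq_add_sq : X ^ 2 + Y ^ 2 + Z ^ 2 = 1
  rotate (θ : ℝ) : ∃ R : A →ₐ[ℝ] A, (∀ f, L (R f) = L f) ∧
    R X = Real.cos θ • X + Real.sin θ • Z ∧ R Y = Y ∧ R Z = Real.cos θ • Z - Real.sin θ • X
  phase : ∃ R : A →ₐ[ℝ] A, (∀ f, L (R f) = L f) ∧ R X = -Y ∧ R Y = X ∧ R Z = Z

namespace IsSphereMean

variable {A : Type*} [CommRing A] [Algebra ℝ A] {L : A →ₗ[ℝ] ℝ} {X Y Z : A}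

lemma map_Z_pow_odd (h : IsSphereMean L X Y Z) {n : ℕ} (hn : Odd n) : L (Z ^ n) = 0 := by
  obtain ⟨R, hR, -, -, hZ⟩ := h.rotate Real.pi
  have := hR (Z ^ n)
  simp [hZ, hn.neg_pow] at this
  linarith

lemma map_X_pow_even (h : IsSphereMean L X Y Z) {n : ℕ} (hn : Even n) :
    L (X ^ n) = L (Z ^ n) := by
  obtain ⟨R, hR, -, -, hZ⟩ := h.rotate (Real.pi / 2)
  simpa [hZ, hn.neg_pow] using hR (Z ^ n)

lemma map_Y_pow (h : IsSphereMean L X Y Z) (n : ℕ) : L (Y ^ n) = L (X ^ n) := by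
  obtain ⟨R, hR, -, hY, -⟩ := h.phase
  simpa [hY] using (hR (Y ^ n)).symm

lemma map_Z_sq (h : IsSphereMean L X Y Z) : L (Z ^ 2) = 1 / 3 := by
  have h1 := h.map_one
  rw [← h.sq_add_sq_add_sq, map_add, map_add, h.map_Y_pow, h.map_X_pow_even even_two] at h1
  linarith

lemma map_Z_pow_four (h : IsSphereMean L X Y Z) : L (Z ^ 4) = 1 / 5 := by
  have hX := h.map_X_pow_even (n := 4) (by decide)
  have hY := h.map_Y_pow 4
  have hYZ : L (Y ^ 2 * Z ^ 2) = L (X ^ 2 * Z ^ 2) := by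
    obtain ⟨R, hR, rX, -, rZ⟩ := h.phase
    rw [← hR (X ^ 2 * Z ^ 2), _root_.map_mul R, map_pow R, map_pow R, rX, rZ, neg_sq]
  have hXY : L (Y ^ 2 * Z ^ 2) = L (X ^ 2 * Y ^ 2) := by
    obtain ⟨R, hR, rX, rY, -⟩ := h.rotate (Real.pi / 2)
    rw [← hR (X ^ 2 * Y ^ 2), _root_.map_mul R, map_pow R, map_pow R, rX, rY, Real.cos_pi_div_two,
      Real.sin_pi_div_two, zero_smul, one_smul, zero_add, mul_comm]
  have hsph : (1 : A) = X ^ 4 + Y ^ 4 + Z ^ 4 + (2 : ℝ) • (X ^ 2 * Y ^ 2)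
      + (2 : ℝ) • (X ^ 2 * Z ^ 2) + (2 : ℝ) • (Y ^ 2 * Z ^ 2) := by
    rw [← one_pow 2, ← h.sq_add_sq_add_sq]
    simp only [Algebra.smul_def, map_ofNat]
    ring
  have hmix : L (X ^ 4) + L (Z ^ 4) =
      (1 / 4 : ℝ) * ((2 : ℝ) * L (X ^ 4) + (2 : ℝ) * L (Z ^ 4) + (12 : ℝ) * L (X ^ 2 * Z ^ 2)) := by
    obtain ⟨R, hR, rX, -, rZ⟩ := h.rotate (Real.pi / 4)
    have h4 : (√2 / 2) ^ 4 = (1 / 4 : ℝ) := by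
      rw [div_pow, show 4 = 2 * 2 from rfl, pow_mul, Real.sq_sqrt (by norm_num)]; norm_num
    have hquart : (X + Z) ^ 4 + (Z - X) ^ 4 =
        (2 : ℝ) • X ^ 4 + (2 : ℝ) • Z ^ 4 + (12 : ℝ) • (X ^ 2 * Z ^ 2) := by
      simp only [Algebra.smul_def, map_ofNat]
      ring
    have hL := congrArg L hquart
    simp only [map_add, map_smul, smul_eq_mul] at hL
    rw [← hL, ← hR (X ^ 4), ← hR (Z ^ 4), map_pow R, map_pow R, rX, rZ, Real.cos_pi_div_four,
      Real.sin_pi_div_four, ← smul_add, ← smul_sub, smul_pow, smul_pow, h4, map_smul, map_smul,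
      smul_eq_mul, smul_eq_mul, mul_add]
  have h1 := h.map_one
  rw [hsph] at h1
  simp only [map_add, map_smul, smul_eq_mul] at h1
  linarith

lemma map_one_add_two_smul_Z_pow_four (h : IsSphereMean L X Y Z) :
    L ((1 + (2 : ℝ) • Z) ^ 4) = 61 / 5 := by
  have : (1 + (2 : ℝ) • Z) ^ 4 =
      1 + (8 : ℝ) • Z ^ 1 + (24 : ℝ) • Z ^ 2 + (32 : ℝ) • Z ^ 3 + (16 : ℝ) • Z ^ 4 := by
    simp only [Algebra.smul_def, map_ofNat]
    ring
  simp only [this, map_add, map_smul, h.map_one, h.map_Z_pow_odd odd_one, h.map_Z_sq,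
    h.map_Z_pow_odd (n := 3) (by decide), h.map_Z_pow_four, smul_eq_mul]
  norm_num

lemma map_one_add_two_smul_rotate_pow_four (h : IsSphereMean L X Y Z) (θ : ℝ) :
    L ((1 + (2 : ℝ) • (Real.cos θ • Z - Real.sin θ • X)) ^ 4) = 61 / 5 := by
  obtain ⟨R, hR, -, -, rZ⟩ := h.rotate θ
  rw [← h.map_one_add_two_smul_Z_pow_four, ← hR ((1 + (2 : ℝ) • Z) ^ 4)]
  simp [rZ]

lemma map_one_sub_Z_sub_pow_four (h : IsSphereMean L X Y Z) :
    L ((1 - Z - √3 • X) ^ 4) = 61 / 5 := by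
  rw [← h.map_one_add_two_smul_rotate_pow_four (Real.pi - Real.pi / 3), Real.cos_pi_sub,
    Real.sin_pi_sub, Real.cos_pi_div_three, Real.sin_pi_div_three]
  congr 2
  module

lemma map_one_sub_Z_add_pow_four (h : IsSphereMean L X Y Z) :
    L ((1 - Z + √3 • X) ^ 4) = 61 / 5 := by
  rw [← h.map_one_add_two_smul_rotate_pow_four (-(Real.pi - Real.pi / 3)), Real.cos_neg,
    Real.sin_neg, Real.cos_pi_sub, Real.sin_pi_sub, Real.cos_pi_div_three, Real.sin_pi_div_three]
  congr 2
  module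

end IsSphereMean

section Averages

variable (μ : Measure (Matrix.unitaryGroup (Fin 2) ℂ)) [μ.IsHaarMeasure] [IsProbabilityMeasure μ]

lemma isSphereMean_haarMean {e : Fin 2 → ℂ} (he : star e ⬝ᵥ e = 1) :
    IsSphereMean (haarMean μ) (onOrbit e blochX continuous_blochX)
      (onOrbit e blochY continuous_blochY) (onOrbit e blochZ continuous_blochZ) where
  map_one := by simp [haarMean]
  sq_add_sq_add_sq := by
    ext U
    exact bloch_sq_of_unit ((star_mulVec_dotProduct_mulVec_of_unitary U e).trans he)
  rotate θ := by
    obtain ⟨g, hg⟩ := exists_unitary_rotate θ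
    refine ⟨leftTranslate g, haarMean_leftTranslate μ g, ?_, ?_, ?_⟩ <;> ext U <;>
      rw [leftTranslate_onOrbit_apply]
    exacts [(hg _).1, (hg _).2.1, (hg _).2.2]
  phase := by
    obtain ⟨g, hg⟩ := exists_unitary_phase
    refine ⟨leftTranslate g, haarMean_leftTranslate μ g, ?_, ?_, ?_⟩ <;> ext U <;>
      rw [leftTranslate_onOrbit_apply]
    exacts [(hg _).1, (hg _).2.1, (hg _).2.2]

lemma integral_MlinI {e : Fin 2 → ℂ} (he : star e ⬝ᵥ e = 1) :
    ∫ U : Matrix.unitaryGroup (Fin 2) ℂ, MlinI ((U : Matrix (Fin 2) (Fin 2) ℂ) *ᵥ e) ∂μ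
      = 1 / 5 := by
  have h := isSphereMean_haarMean μ he
  set X := onOrbit e blochX continuous_blochX
  set Y := onOrbit e blochY continuous_blochY
  set Z := onOrbit e blochZ continuous_blochZ
  have key : ∫ U : Matrix.unitaryGroup (Fin 2) ℂ, MlinI ((U : Matrix (Fin 2) (Fin 2) ℂ) *ᵥ e) ∂μ =
      haarMean μ (1 - (2⁻¹ : ℝ) • (1 + X ^ 4 + Y ^ 4 + Z ^ 4)) :=
    integral_congr_ae <| .of_forall fun U =>
      MlinI_of_unit ((star_mulVec_dotProduct_mulVec_of_unitary U e).trans he)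
  simp only [key, map_sub, map_add, map_smul, h.map_one, h.map_Y_pow,
    h.map_X_pow_even (n := 4) (by decide), h.map_Z_pow_four, smul_eq_mul]
  norm_num

lemma integral_Mlin0 {e : Fin 2 → ℂ} (he : star e ⬝ᵥ e = 1) :
    ∫ U : Matrix.unitaryGroup (Fin 2) ℂ, Mlin0 (((U : Matrix (Fin 2) (Fin 2) ℂ) *ᵥ e) 0 • zeroS
      + ((U : Matrix (Fin 2) (Fin 2) ℂ) *ᵥ e) 1 • oneS) ∂μ = 17 / 45 := by
  have h := isSphereMean_haarMean μ he
  set X := onOrbit e blochX continuous_blochX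
  set Y := onOrbit e blochY continuous_blochY
  set Z := onOrbit e blochZ continuous_blochZ
  have key : ∫ U : Matrix.unitaryGroup (Fin 2) ℂ,
        Mlin0 (((U : Matrix (Fin 2) (Fin 2) ℂ) *ᵥ e) 0 • zeroS
          + ((U : Matrix (Fin 2) (Fin 2) ℂ) *ᵥ e) 1 • oneS) ∂μ =
      haarMean μ (1 - (16⁻¹ : ℝ) • ((4 : ℝ) • 1 + (12 / 81 : ℝ) • ((1 + (2 : ℝ) • Z) ^ 4
        + (1 - Z + √3 • X) ^ 4 + (1 - Z - √3 • X) ^ 4) + (24 / 9 : ℝ) • Y ^ 4)) := by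
    refine integral_congr_ae <| .of_forall fun U => (Mlin0_of_unit
      ((star_mulVec_dotProduct_mulVec_of_unitary U e).trans he)).trans ?_
    simp only [X, Y, Z, onOrbit, ContinuousMap.sub_apply, ContinuousMap.add_apply,
      ContinuousMap.smul_apply, ContinuousMap.pow_apply, ContinuousMap.one_apply,
      ContinuousMap.coe_mk, smul_eq_mul, mul_one]
  simp only [key, map_sub, map_add, map_smul, h.map_one, h.map_Y_pow,
    h.map_X_pow_even (n := 4) (by decide), h.map_Z_pow_four, h.map_one_add_two_smul_Z_pow_four,
    h.map_one_sub_Z_sub_pow_four, h.map_one_sub_Z_add_pow_four, smul_eq_mul]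
  norm_num

end Averages

/-- the average stabilizer-entropy gap of the SU(2)-gauge invariant
intertwiner subspace of four qubits equals 8/45:
`ΔM(H_I) = ∫ M_lin⁽⁰⁾(u₀₀|0_s⟩ + u₁₀|1_s⟩) dμ(U) − ∫ M_lin⁽ᴵ⁾(U e₀) dμ(U)
         = 17/45 − 1/5 = 8/45`. -/
theorem average_SE_gap_intertwiner
    (e₀ : Fin 2 → ℂ) (he₀ : star e₀ ⬝ᵥ e₀ = 1)
    (μ : Measure (Matrix.unitaryGroup (Fin 2) ℂ)) [μ.IsHaarMeasure]
    [IsProbabilityMeasure μ] :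
    (∫ U : Matrix.unitaryGroup (Fin 2) ℂ,
        Mlin0 (((U : Matrix (Fin 2) (Fin 2) ℂ) 0 0) • zeroS +
               ((U : Matrix (Fin 2) (Fin 2) ℂ) 1 0) • oneS) ∂μ) -
      (∫ U : Matrix.unitaryGroup (Fin 2) ℂ,
        MlinI ((U : Matrix (Fin 2) (Fin 2) ℂ).mulVec e₀) ∂μ) = 17 / 45 - 1 / 5 ∧
    (17 / 45 - 1 / 5 : ℝ) = 8 / 45 := by
  refine ⟨?_, by norm_num⟩
  have h1 : star (Pi.single 0 1 : Fin 2 → ℂ) ⬝ᵥ Pi.single 0 1 = 1 := by simp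
  have h := integral_Mlin0 μ h1
  simp only [mulVec_single_one, col_apply] at h
  rw [h, integral_MlinI μ he₀]
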